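/- (The permutation-invariant code weights satisfy the moment-matching conditions.) Let t be an odd positive integer and m := 9t² + 4t. For j ∈ {0,1} and 0 ≤ b ≤ m define λ_{j,b} := C(3t+1, b/(3t)) · 2^{−3t} if 3t divides b and b + j is even, and λ_{j,b} := 0 otherwise. Then for all natural numbers c ≤ t and ℓ ≤ 2t, Σ_{b=0}^m λ_{0,b} C(m−b, c) C(b, ℓ) = Σ_{b=0}^m λ_{1,b} C(m−b, c) C(b, ℓ). -/

import Mathlib

open scoped BigOperators

theorem Polynomial.sum_neg_one_pow_mul_choose_mul_eval_eq_zero {R : Type*} [CommRing R]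
    {P : Polynomial R} {n : ℕ} (hP : P.natDegree < n) :
    ∑ k ∈ Finset.range (n + 1), (-1 : R) ^ k * (n.choose k : R) * P.eval (k : R) = 0 := by
  have h := congrFun (Polynomial.fwdDiff_iter_eq_zero_of_degree_lt hP) 0
  rw [fwdDiff_iter_eq_sum_shift] at h
  have h' := congrArg ((-1 : R) ^ n * ·) h
  simp only [Pi.zero_apply, mul_zero, Finset.mul_sum] at h'
  rw [← h']
  refine Finset.sum_congr rfl fun k hk => ?_
  have hkn : k ≤ n := Nat.lt_succ_iff.mp (Finset.mem_range.mp hk)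
  have hpow : (-1 : R) ^ k = (-1) ^ n * (-1) ^ (n - k) := by
    obtain ⟨d, rfl⟩ := Nat.exists_eq_add_of_le hkn
    rw [Nat.add_sub_cancel_left, pow_add, mul_assoc, ← mul_pow]
    simp
  rw [hpow, zsmul_eq_mul]
  push_cast
  simp only [zero_add, nsmul_eq_mul, mul_one]
  ring

open Polynomial in
/-- The product `(m - d k).choose c * (d k).choose l` is a polynomial of degree at most `c + l` in `k`,
so its alternating binomial sum of any larger order vanishes. -/
theorem sum_neg_one_pow_mul_choose_mul_choose_mul_choose_eq_zero {K : Type*} [Field K] [CharZero K]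
    {n c l d m : ℕ} (hn : c + l < n) (hm : d * n ≤ m) :
    ∑ k ∈ Finset.range (n + 1), (-1 : K) ^ k * (n.choose k : K) *
      (((m - d * k).choose c : K) * ((d * k).choose l : K)) = 0 := by
  set P : K[X] := (descPochhammer K c).comp (C (m : K) - C (d : K) * X) *
    (descPochhammer K l).comp (C (d : K) * X) with hPdef
  have hlin : (C (d : K) * X : K[X]).natDegree ≤ 1 := (natDegree_C_mul_le _ _).trans natDegree_X_le
  have hP : P.natDegree < n := by
    refine lt_of_le_of_lt ?_ hn
    refine natDegree_mul_le.trans (add_le_add ?_ ?_)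
    · refine natDegree_comp_le.trans ?_
      rw [descPochhammer_natDegree]
      have : (C (m : K) - C (d : K) * X : K[X]).natDegree ≤ 1 :=
        (natDegree_sub_le _ _).trans (by simpa using hlin)
      simpa using Nat.mul_le_mul_left c this
    · refine natDegree_comp_le.trans ?_
      rw [descPochhammer_natDegree]
      simpa using Nat.mul_le_mul_left l hlin
  have h := congrArg (· / ((c.factorial : K) * (l.factorial : K)))
    (sum_neg_one_pow_mul_choose_mul_eval_eq_zero hP)
  simp only [zero_div, Finset.sum_div] at h
  rw [← h]
  refine Finset.sum_congr rfl fun k hk => ?_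
  have hkm : d * k ≤ m :=
    (Nat.mul_le_mul_left d (Nat.lt_succ_iff.mp (Finset.mem_range.mp hk))).trans hm
  rw [Nat.cast_choose_eq_descPochhammer_div K (m - d * k),
    Nat.cast_choose_eq_descPochhammer_div K (d * k), hPdef]
  simp only [eval_mul, eval_comp, eval_sub, eval_C, eval_X, Nat.cast_sub hkm, Nat.cast_mul]
  ring

/-- A sum over the multiples of `d` that are at most `m`. -/
theorem Finset.sum_range_eq_sum_range_mul {M : Type*} [AddCommMonoid M] {d n m : ℕ} (hd : 0 < d)
    (h₁ : d * n ≤ m) (h₂ : m < d * (n + 1)) {f : ℕ → M} (hf : ∀ b, ¬ d ∣ b → f b = 0) :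
    ∑ b ∈ Finset.range (m + 1), f b = ∑ k ∈ Finset.range (n + 1), f (d * k) := by
  refine (Finset.sum_of_injOn (d * ·) ?_ ?_ ?_ fun _ _ => rfl).symm
  · exact fun a _ b _ hab => Nat.eq_of_mul_eq_mul_left hd hab
  · intro k hk
    simp only [Finset.coe_range, Set.mem_Iio] at hk ⊢
    have := Nat.mul_le_mul_left d (Nat.lt_succ_iff.mp hk)
    omega
  · intro b hb hb'
    refine hf b ?_
    rintro ⟨k, rfl⟩
    refine hb' ⟨k, ?_, rfl⟩
    simp only [Finset.coe_range, Set.mem_Iio]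
    exact Nat.lt_of_mul_lt_mul_left ((Nat.lt_succ_iff.mp (Finset.mem_range.mp hb)).trans_lt h₂)

theorem stmt13 (t : ℕ) (ht : Odd t) (htpos : 0 < t) (m : ℕ) (hm : m = 9 * t ^ 2 + 4 * t)
    (lam : Fin 2 → ℕ → ℝ)
    (hlam : ∀ (j : Fin 2) (b : ℕ), lam j b =
      if 3 * t ∣ b ∧ Even (b + (j : ℕ))
        then (Nat.choose (3 * t + 1) (b / (3 * t)) : ℝ) / 2 ^ (3 * t) else 0) :
    ∀ c ≤ t, ∀ ℓ ≤ 2 * t,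
      ∑ b ∈ Finset.range (m + 1),
          lam 0 b * (Nat.choose (m - b) c : ℝ) * (Nat.choose b ℓ : ℝ) =
        ∑ b ∈ Finset.range (m + 1),
          lam 1 b * (Nat.choose (m - b) c : ℝ) * (Nat.choose b ℓ : ℝ) := by
  intro c hc l hl
  have hodd : Odd (3 * t) := Odd.mul (by decide) ht
  rw [← sub_eq_zero, ← Finset.sum_sub_distrib,
    Finset.sum_range_eq_sum_range_mul (d := 3 * t) (n := 3 * t + 1) (by omega)
      (by rw [hm]; nlinarith) (by rw [hm]; nlinarith)
      (fun b hb => by simp [hlam, hb])]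
  have key := sum_neg_one_pow_mul_choose_mul_choose_mul_choose_eq_zero (K := ℝ)
    (n := 3 * t + 1) (c := c) (l := l) (d := 3 * t) (m := m) (by omega) (by rw [hm]; nlinarith)
  have h := congrArg (· / (2 : ℝ) ^ (3 * t)) key
  simp only [zero_div, Finset.sum_div] at h
  rw [← h]
  refine Finset.sum_congr rfl fun k _ => ?_
  rw [hlam, hlam, Nat.mul_div_cancel_left k (by omega : 0 < 3 * t)]
  rcases Nat.even_or_odd k with hk | hk
  · have h0 : Even (3 * t * k) := hk.mul_left _
    have h1 : ¬ Even (3 * t * k + 1) := by simpa [Nat.even_add_one] using h0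
    simp only [Fin.val_zero, Fin.val_one, add_zero, h0, h1, dvd_mul_right, and_true, and_false,
      if_true, if_false, hk.neg_one_pow]
    ring
  · have h0 : ¬ Even (3 * t * k) := Nat.not_even_iff_odd.mpr (hodd.mul hk)
    have h1 : Even (3 * t * k + 1) := Nat.even_add_one.mpr h0
    simp only [Fin.val_zero, Fin.val_one, add_zero, h0, h1, dvd_mul_right, and_true, and_false,
      if_true, if_false, hk.neg_one_pow]
    ring
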